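/- Let K ≥ 1, π with distinct positive values, unit sizes, integral capacities. If n is the allocation output of the Collaborative Caching Algorithm (greedy fill by decreasing popularity followed by compare-and-replace with threshold d/(N·D−(N−1)·d) applied between the last multi-copy video and the first uncached video until the ratio test fails or a set empties), then f(n) = ∑_k π_k[d·n_k + N(D−d)·min(n_k,1)] equals the maximum of f over all feasible binary allocations satisfying the cache capacity constraints. -/

import Mathlib

open Classical in
/-- One run of Phase II (compare-and-replace) of the Collaborative Caching
Algorithm, with `fuel` bounding the number of replacement steps.  At each step,
`k1` is the last (largest-index, i.e. least popular) video cached more than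
once and `k2` is the first (smallest-index, i.e. most popular) uncached video;
if the popularity ratio test `π k2 / π k1 > d / (N·D − (N−1)·d)` passes, one
copy of `k1` is replaced by `k2`. -/
noncomputable def ccaPhase2 (K N : ℕ) (d D : ℝ) (π : Fin K → ℝ) :
    ℕ → (Fin K → ℕ) → (Fin K → ℕ)
  | 0, n => n
  | fuel + 1, n =>
    let Sgt1 := Finset.univ.filter (fun k : Fin K => 1 < n k)
    let S0 := Finset.univ.filter (fun k : Fin K => n k = 0)
    if h : Sgt1.Nonempty ∧ S0.Nonempty then
      let k1 := Sgt1.max' h.1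
      let k2 := S0.min' h.2
      if π k2 / π k1 > d / ((N : ℝ) * D - ((N : ℝ) - 1) * d) then
        ccaPhase2 K N d D π fuel
          (Function.update (Function.update n k1 (n k1 - 1)) k2 1)
      else n
    else n

/-- Phase I (greedy filling): cache `i`, of capacity `C i`, stores the `C i`
most popular videos, so video `k` receives one copy in every cache whose
capacity exceeds its (0-based) popularity rank. -/
def ccaPhase1 (N K : ℕ) (C : Fin N → ℕ) (k : Fin K) : ℕ :=
  (Finset.univ.filter (fun i : Fin N => (k : ℕ) < C i)).card

theorem cca_dom_one (K c0 : ℕ) (c : Fin K → ℝ) (hc : Antitone c) (hc0 : ∀ k, 0 ≤ c k)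
    (x : Fin K → ℕ) (hx : ∀ k, x k = 0 ∨ x k = 1) (hs : ∑ k, x k ≤ c0) :
    ∑ k, c k * (x k : ℝ) ≤ ∑ k : Fin K, c k * (if (k : ℕ) < c0 then (1 : ℝ) else 0) := by
  by_cases h : c0 < K
  · have h1 : ∑ k : Fin K, (if (k : ℕ) < c0 then (1 : ℝ) else 0) = c0 := by
      rw [Fin.sum_univ_eq_sum_range (fun k => if k < c0 then (1 : ℝ) else 0) K,
        Finset.sum_ite, Finset.sum_const_zero, add_zero, Finset.sum_const, nsmul_eq_mul, mul_one]
      congr 1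
      have : (Finset.range K).filter (fun k => k < c0) = Finset.range c0 := by
        ext a; simp; omega
      rw [this, Finset.card_range]
    have h2 : ∑ k, (x k : ℝ) ≤ c0 := by exact_mod_cast hs
    set e := c ⟨c0, h⟩ with he
    have he0 : 0 ≤ e := hc0 _
    have h3 : ∑ k, (c k - e) * (x k : ℝ)
        ≤ ∑ k : Fin K, (c k - e) * (if (k : ℕ) < c0 then (1 : ℝ) else 0) := by
      apply Finset.sum_le_sum
      intro k _
      split_ifs with hk
      · have : e ≤ c k := hc (show k ≤ ⟨c0, h⟩ from Fin.le_def.2 hk.le)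
        rcases hx k with h | h <;> simp [h] <;> linarith
      · have : c k ≤ e := hc (show ⟨c0, h⟩ ≤ k from Fin.le_def.2 (not_lt.1 hk))
        rcases hx k with h | h <;> simp [h] <;> linarith
    simp only [sub_mul, Finset.sum_sub_distrib, ← Finset.mul_sum] at h3
    rw [h1] at h3
    nlinarith
  · apply Finset.sum_le_sum
    intro k _
    have : (k : ℕ) < c0 := by omega
    rw [if_pos this]
    have := hc0 k
    rcases hx k with h | h <;> simp [h] ; linarith

theorem cca_dom (N K : ℕ) (C : Fin N → ℕ) (c : Fin K → ℝ) (hc : Antitone c)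
    (hc0 : ∀ k, 0 ≤ c k) (x : Fin N → Fin K → ℕ) (hx : ∀ i k, x i k = 0 ∨ x i k = 1)
    (hs : ∀ i, ∑ k, x i k ≤ C i) :
    ∑ k, c k * ((∑ i, x i k : ℕ) : ℝ) ≤ ∑ k, c k * (ccaPhase1 N K C k : ℝ) := by
  have h1 : ∀ k, c k * (ccaPhase1 N K C k : ℝ)
      = ∑ i, c k * (if (k : ℕ) < C i then (1 : ℝ) else 0) := by
    intro k
    rw [← Finset.mul_sum, ccaPhase1, Finset.sum_boole]
  simp only [h1]
  push_cast
  simp only [Finset.mul_sum]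
  rw [Finset.sum_comm, Finset.sum_comm (s := Finset.univ (α := Fin K))]
  exact Finset.sum_le_sum fun i _ => cca_dom_one K (C i) c hc hc0 (x i) (hx i) (hs i)

/-- The sufficient optimality condition with multiplier `l`. -/
theorem cca_opt (N K : ℕ) (C : Fin N → ℕ) (π : Fin K → ℝ) (hpos : ∀ k, 0 < π k)
    (hanti : StrictAnti π) (d B l : ℝ) (hd : 0 < d) (hB : 0 ≤ B) (hl : 0 ≤ l)
    (n : Fin K → ℕ) (hsum : ∑ k, n k = ∑ k, ccaPhase1 N K C k)
    (h1 : ∀ k, l < d * π k → n k = ccaPhase1 N K C k)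
    (h2 : ∀ k, d * π k < l → n k ≤ 1)
    (h3 : ∀ k, n k = 0 → (d + B) * π k ≤ l)
    (h4 : ∀ k, n k ≠ 0 → l ≤ (d + B) * π k)
    (x : Fin N → Fin K → ℕ) (hx : ∀ i k, x i k = 0 ∨ x i k = 1)
    (hs : ∀ i, ∑ k, x i k ≤ C i) :
    ∑ k, π k * (d * ((∑ i, x i k : ℕ) : ℝ) + B * ((min (∑ i, x i k) 1 : ℕ) : ℝ))
      ≤ ∑ k, π k * (d * (n k : ℝ) + B * ((min (n k) 1 : ℕ) : ℝ)) := by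
  have hA := cca_dom N K C (fun k => max (d * π k - l) 0)
    (by
      intro a b hab
      have := hanti.antitone hab
      have : d * π b ≤ d * π a := by gcongr
      exact max_le_max (by linarith) le_rfl)
    (fun k => le_max_right _ _) x hx hs
  have hT := cca_dom N K C (fun _ => l) (fun _ _ _ => le_rfl) (fun _ => hl) x hx hs
  have hE : ∑ k, max (d * π k - l) 0 * (ccaPhase1 N K C k : ℝ)
      = ∑ k, max (d * π k - l) 0 * (n k : ℝ) := by
    apply Finset.sum_congr rfl
    intro k _
    by_cases h : l < d * π k
    · rw [h1 k h]
    · rw [max_eq_right (by linarith)]; simp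
  have hF : ∑ k, l * (ccaPhase1 N K C k : ℝ) = ∑ k, l * (n k : ℝ) := by
    rw [← Finset.mul_sum, ← Finset.mul_sum]
    congr 1
    exact_mod_cast hsum.symm
  have key : ∀ k (y : ℕ), B * π k * ((min y 1 : ℕ) : ℝ) - max (l - d * π k) 0 * (y : ℝ)
      ≤ B * π k * ((min (n k) 1 : ℕ) : ℝ) - max (l - d * π k) 0 * (n k : ℝ) := by
    intro k y
    have he : 0 ≤ max (l - d * π k) 0 := le_max_right _ _
    have hBp : 0 ≤ B * π k := mul_nonneg hB (hpos k).le
    have hR : n k ≠ 0 → B * π k * ((min (n k) 1 : ℕ) : ℝ) - max (l - d * π k) 0 * (n k : ℝ)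
        = B * π k - max (l - d * π k) 0 := by
      intro hn0
      rw [min_eq_right (by omega)]
      by_cases hlt : d * π k < l
      · have : n k = 1 := by have := h2 k hlt; omega
        rw [this]; simp
      · rw [max_eq_right (by linarith)]; simp
    by_cases hy : y = 0
    · subst hy
      by_cases hn0 : n k = 0
      · rw [hn0]
      · rw [hR hn0]
        have := h4 k hn0
        have : max (l - d * π k) 0 ≤ B * π k := max_le (by linarith) hBp
        simpa using this
    · have hy1 : (1 : ℝ) ≤ y := by exact_mod_cast Nat.one_le_iff_ne_zero.2 hy
      have hL : B * π k * ((min y 1 : ℕ) : ℝ) - max (l - d * π k) 0 * (y : ℝ)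
          ≤ B * π k - max (l - d * π k) 0 := by
        rw [min_eq_right (by omega)]
        push_cast
        nlinarith
      refine hL.trans ?_
      by_cases hn0 : n k = 0
      · have := h3 k hn0
        have : l - d * π k ≤ max (l - d * π k) 0 := le_max_left _ _
        rw [hn0]; simp only [zero_le, inf_of_le_left, Nat.cast_zero, mul_zero]
        linarith
      · rw [hR hn0]
  have split : ∀ (y : Fin K → ℕ),
      ∑ k, π k * (d * (y k : ℝ) + B * ((min (y k) 1 : ℕ) : ℝ))
      = ∑ k, max (d * π k - l) 0 * (y k : ℝ) + ∑ k, l * (y k : ℝ)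
        + ∑ k, (B * π k * ((min (y k) 1 : ℕ) : ℝ) - max (l - d * π k) 0 * (y k : ℝ)) := by
    intro y
    rw [← Finset.sum_add_distrib, ← Finset.sum_add_distrib]
    apply Finset.sum_congr rfl
    intro k _
    rcases le_total (d * π k) l with h | h
    · rw [max_eq_right (by linarith), max_eq_left (by linarith)]; ring
    · rw [max_eq_left (by linarith), max_eq_right (by linarith)]; ring
  rw [split (fun k => ∑ i, x i k), split n]
  have hG := Finset.sum_le_sum (s := Finset.univ) (fun k _ => key k (∑ i, x i k))
  linarith

/-- Loop invariant of Phase II. -/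
structure CcaInv (N K : ℕ) (C : Fin N → ℕ) (π : Fin K → ℝ) (d B : ℝ) (n : Fin K → ℕ) : Prop where
  feas : ∃ x : Fin N → Fin K → ℕ, (∀ i k, x i k = 0 ∨ x i k = 1) ∧ (∀ i, ∑ k, x i k ≤ C i)
    ∧ ∀ k, ∑ i, x i k = n k
  sum : ∑ k, n k = ∑ k, ccaPhase1 N K C k
  down : ∀ k l, k ≤ l → n k = 0 → n l = 0
  mult : ∃ m : ℝ, 0 ≤ m ∧ (∀ k, m < d * π k → n k = ccaPhase1 N K C k)
    ∧ (∀ k, d * π k < m → n k ≤ 1) ∧ (∀ k, n k ≠ 0 → m ≤ (d + B) * π k)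

theorem cca_inv_start (N K : ℕ) (C : Fin N → ℕ) (π : Fin K → ℝ) (hpos : ∀ k, 0 < π k)
    (d B : ℝ) (hd : 0 < d) (hB : 0 ≤ B) : CcaInv N K C π d B (ccaPhase1 N K C) := by
  refine ⟨⟨fun i k => if (k : ℕ) < C i then 1 else 0, ?_, ?_, ?_⟩, rfl, ?_, 0, le_rfl, ?_, ?_, ?_⟩
  · intro i k; dsimp only; split_ifs <;> simp
  · intro i
    rw [Fin.sum_univ_eq_sum_range (fun k => if k < C i then 1 else 0) K, Finset.sum_boole]
    calc _ ≤ (Finset.range (C i)).card := by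
          apply Finset.card_le_card
          intro a; simp
      _ = C i := Finset.card_range _
  · intro k; rw [Finset.sum_boole]; rfl
  · intro k l hkl h
    unfold ccaPhase1 at *
    rw [Finset.card_eq_zero, Finset.filter_eq_empty_iff] at *
    intro i hi
    have := h hi
    have : (k : ℕ) ≤ l := hkl
    omega
  · intros; rfl
  · intro k h
    have := mul_pos hd (hpos k)
    linarith
  · intro k _
    exact mul_nonneg (by linarith) (hpos k).le

theorem cca_inv_step (N K : ℕ) (C : Fin N → ℕ) (π : Fin K → ℝ) (hpos : ∀ k, 0 < π k)
    (hanti : StrictAnti π) (d B : ℝ) (hd : 0 < d) (hB : 0 ≤ B) (n : Fin K → ℕ)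
    (hI : CcaInv N K C π d B n) (k1 k2 : Fin K) (hk1 : 1 < n k1) (hmax : ∀ k, 1 < n k → k ≤ k1)
    (hk2 : n k2 = 0) (hmin : ∀ k, n k = 0 → k2 ≤ k) (ht : d * π k1 < (d + B) * π k2) :
    CcaInv N K C π d B (Function.update (Function.update n k1 (n k1 - 1)) k2 1) := by
  obtain ⟨⟨x, hx, hxC, hxn⟩, hsum, hdown, m, hm0, hm1, hm2, hm3⟩ := hI
  have hne : k1 ≠ k2 := by rintro rfl; omega
  have hlt : k1 < k2 := by
    rcases lt_or_ge k1 k2 with h | h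
    · exact h
    · have := hdown _ _ h hk2; omega
  have hmk : m ≤ d * π k1 := by
    by_contra h
    have := hm2 k1 (not_le.1 h)
    omega
  have hval : ∀ k, Function.update (Function.update n k1 (n k1 - 1)) k2 1 k
      = if k = k2 then 1 else if k = k1 then n k1 - 1 else n k := by
    intro k; simp only [Function.update_apply]
  -- the sum of a doubly updated function
  have hupd : ∀ (f : Fin K → ℕ), 1 ≤ f k1 → f k2 = 0 →
      ∑ k, (if k = k2 then 1 else if k = k1 then f k1 - 1 else f k) = ∑ k, f k := by
    intro f hf1 hf2
    have hmem : k1 ∈ Finset.univ.erase k2 := by simp [hne]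
    rw [← Finset.add_sum_erase _ _ (Finset.mem_univ k2), ← Finset.add_sum_erase _ _ hmem,
      ← Finset.add_sum_erase _ f (Finset.mem_univ k2), ← Finset.add_sum_erase _ f hmem]
    have : ∑ k ∈ (Finset.univ.erase k2).erase k1,
        (if k = k2 then 1 else if k = k1 then f k1 - 1 else f k)
        = ∑ k ∈ (Finset.univ.erase k2).erase k1, f k := by
      apply Finset.sum_congr rfl
      intro k hk
      simp only [Finset.mem_erase] at hk
      rw [if_neg hk.2.1, if_neg hk.1]
    rw [this, if_pos rfl, if_neg hne, if_pos rfl, hf2]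
    omega
  refine ⟨?_, ?_, ?_, d * π k1, (mul_pos hd (hpos _)).le, ?_, ?_, ?_⟩
  · obtain ⟨i, hi⟩ : ∃ i, x i k1 = 1 := by
      by_contra h
      push Not at h
      have : ∑ i, x i k1 = 0 := Finset.sum_eq_zero fun i _ => by
        rcases hx i k1 with h' | h'
        · exact h'
        · exact absurd h' (h i)
      rw [hxn] at this; omega
    have h0 : ∀ j, x j k2 = 0 := by
      intro j
      have := hxn k2
      rw [hk2, Finset.sum_eq_zero_iff] at this
      exact this j (Finset.mem_univ _)
    refine ⟨fun j k => if j = i then (if k = k2 then 1 else if k = k1 then x j k1 - 1 else x j k)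
      else x j k, ?_, ?_, ?_⟩
    · intro j k
      have := hx j k
      dsimp only
      split_ifs with h1 h2 h3
      · simp
      · subst h1; omega
      · exact this
      · exact this
    · intro j
      by_cases hj : j = i
      · simp only [if_pos hj]
        rw [hupd (x j) (by rw [hj, hi]) (h0 j)]
        exact hxC j
      · simp only [if_neg hj]; exact hxC j
    · intro k
      rw [hval]
      have hsplit : ∀ f : Fin N → ℕ, ∑ j, f j = f i + ∑ j ∈ Finset.univ.erase i, f j :=
        fun f => (Finset.add_sum_erase _ f (Finset.mem_univ i)).symm
      have hr : ∑ j ∈ Finset.univ.erase i, (if j = i then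
          (if k = k2 then 1 else if k = k1 then x j k1 - 1 else x j k) else x j k)
          = ∑ j ∈ Finset.univ.erase i, x j k := by
        apply Finset.sum_congr rfl
        intro j hj
        rw [if_neg (Finset.ne_of_mem_erase hj)]
      have hk := hxn k
      rw [hsplit] at hk
      rw [hsplit, hr]
      simp only [if_true]
      split_ifs with h1 h2
      · subst h1; rw [h0 i, hk2] at hk; omega
      · subst h2; rw [hi] at hk ⊢; omega
      · exact hk
  · rw [← hsum, ← hupd n hk1.le hk2]
    exact Finset.sum_congr rfl fun k _ => hval k
  · intro k l hkl
    rw [hval, hval]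
    intro h
    split_ifs at h with ha hb
    · omega
    · have h2 := hmin k h
      have h3 : k2 < l := lt_of_lt_of_le (lt_of_le_of_ne h2 (Ne.symm ha)) hkl
      rw [if_neg h3.ne', if_neg (hlt.trans h3).ne']
      exact hdown _ _ hkl h
  · intro k hk
    have hk' : π k1 < π k := lt_of_mul_lt_mul_left hk hd.le
    have hkk : k < k1 := hanti.lt_iff_gt.1 hk'
    rw [hval, if_neg (hkk.trans hlt).ne, if_neg hkk.ne]
    exact hm1 k (by linarith)
  · intro k hk
    have hk' : π k < π k1 := lt_of_mul_lt_mul_left hk hd.le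
    have hkk : k1 < k := hanti.lt_iff_gt.1 hk'
    rw [hval, if_neg hkk.ne']
    split_ifs
    · exact le_rfl
    · by_contra h
      exact absurd (hmax k (not_le.1 h)) (not_le.2 hkk)
  · intro k hk
    have hle : k ≤ k2 := by
      rw [hval] at hk
      split_ifs at hk with ha hb
      · exact ha.le
      · exact hb ▸ hlt.le
      · by_contra h
        exact hk (hdown _ _ (not_le.1 h).le hk2)
    have := hanti.antitone hle
    have : (d + B) * π k2 ≤ (d + B) * π k := by gcongr
    linarith

theorem cca_phase2_spec (N K : ℕ) (C : Fin N → ℕ) (π : Fin K → ℝ) (hpos : ∀ k, 0 < π k)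
    (hanti : StrictAnti π) (d D : ℝ) (hd : 0 < d) (hB : 0 ≤ (N : ℝ) * (D - d)) (fuel : ℕ) :
    ∀ n : Fin K → ℕ, CcaInv N K C π d ((N : ℝ) * (D - d)) n →
      (Finset.univ.filter (fun k : Fin K => n k = 0)).card ≤ fuel →
      CcaInv N K C π d ((N : ℝ) * (D - d)) (ccaPhase2 K N d D π fuel n) ∧
      ∀ k1 k2, 1 < ccaPhase2 K N d D π fuel n k1 → ccaPhase2 K N d D π fuel n k2 = 0 →
        (d + (N : ℝ) * (D - d)) * π k2 ≤ d * π k1 := by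
  have hden : (N : ℝ) * D - ((N : ℝ) - 1) * d = d + (N : ℝ) * (D - d) := by ring
  have hden0 : 0 < d + (N : ℝ) * (D - d) := by linarith
  have htest : ∀ a b : Fin K, π b / π a > d / ((N : ℝ) * D - ((N : ℝ) - 1) * d) ↔
      d * π a < (d + (N : ℝ) * (D - d)) * π b := by
    intro a b
    rw [hden, gt_iff_lt, div_lt_div_iff₀ hden0 (hpos a), mul_comm (π b)]
  induction fuel with
  | zero =>
    intro n hI hc
    refine ⟨hI, ?_⟩
    intro k1 k2 _ h2
    have : k2 ∈ Finset.univ.filter (fun k : Fin K => n k = 0) := by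
      rw [ccaPhase2] at h2
      simpa using h2
    have := Finset.card_pos.2 ⟨k2, this⟩
    omega
  | succ fuel ih =>
    intro n hI hc
    rw [ccaPhase2]
    dsimp only
    split_ifs with h ht
    · set k1 := (Finset.univ.filter (fun k : Fin K => 1 < n k)).max' h.1 with hk1
      set k2 := (Finset.univ.filter (fun k : Fin K => n k = 0)).min' h.2 with hk2
      have m1 : 1 < n k1 := by
        simpa using (Finset.mem_filter.1 (Finset.max'_mem _ h.1)).2
      have m2 : n k2 = 0 := by
        simpa using (Finset.mem_filter.1 (Finset.min'_mem _ h.2)).2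
      apply ih
      · refine cca_inv_step N K C π hpos hanti d _ hd hB n hI k1 k2 m1 ?_ m2 ?_ ((htest _ _).1 ht)
        · intro k hk; exact Finset.le_max' _ _ (by simpa using hk)
        · intro k hk; exact Finset.min'_le _ _ (by simpa using hk)
      · have : (Finset.univ.filter (fun k : Fin K =>
            Function.update (Function.update n k1 (n k1 - 1)) k2 1 k = 0)) ⊂
            Finset.univ.filter (fun k : Fin K => n k = 0) := by
          rw [Finset.ssubset_iff_of_subset]
          · exact ⟨k2, by simpa using m2, by simp⟩
          · intro k
            simp only [Finset.mem_filter, Finset.mem_univ, true_and, Function.update_apply]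
            split_ifs with ha hb
            · intro hz; exact hz.elim
            · intro hz; omega
            · exact id
        have := Finset.card_lt_card this
        omega
    · refine ⟨hI, ?_⟩
      intro a b ha hb
      rw [htest, not_lt] at ht
      have h1 := Finset.le_max' (Finset.univ.filter (fun k : Fin K => 1 < n k)) a (by simpa using ha)
      have h2 := Finset.min'_le (Finset.univ.filter (fun k : Fin K => n k = 0)) b (by simpa using hb)
      have h3 := mul_le_mul_of_nonneg_left (hanti.antitone h1) hd.le
      have h4 := mul_le_mul_of_nonneg_left (hanti.antitone h2) hden0.le
      linarith
    · refine ⟨hI, ?_⟩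
      intro a b ha hb
      exact absurd ⟨⟨a, by simpa using ha⟩, ⟨b, by simpa using hb⟩⟩ h

/-- Theorem 1 of the paper: for unit-size videos, pairwise-distinct
popularities sorted in decreasing order and integral cache capacities, the
allocation computed by the Collaborative Caching Algorithm (greedy filling
followed by compare-and-replace) attains the maximum of the objective
`f(n) = ∑ₖ πₖ (d·nₖ + N(D−d)·min(nₖ,1))` over all feasible binary
allocations. -/
theorem stmt_18 (N K : ℕ) (hN : 1 ≤ N) (hK : 1 ≤ K)
    (C : Fin N → ℕ)
    (π : Fin K → ℝ) (hpos : ∀ k, 0 < π k) (hanti : StrictAnti π)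
    (d D : ℝ) (hd : 0 < d) (hdD : d < D)
    (n : Fin K → ℕ)
    (hn : n = ccaPhase2 K N d D π K (ccaPhase1 N K C)) :
    IsGreatest
      ((fun x : Fin N → Fin K → ℕ =>
          ∑ k, π k * (d * ((∑ i, x i k : ℕ) : ℝ)
            + (N : ℝ) * (D - d) * ((min (∑ i, x i k) 1 : ℕ) : ℝ))) ''
        {x | (∀ i k, x i k = 0 ∨ x i k = 1) ∧ ∀ i, ∑ k, x i k ≤ C i})
      (∑ k, π k * (d * (n k : ℝ) + (N : ℝ) * (D - d) * ((min (n k) 1 : ℕ) : ℝ))) := by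
  have hB : 0 ≤ (N : ℝ) * (D - d) := mul_nonneg (Nat.cast_nonneg _) (by linarith)
  obtain ⟨hI, hF⟩ := cca_phase2_spec N K C π hpos hanti d D hd hB K (ccaPhase1 N K C)
    (cca_inv_start N K C π hpos d _ hd hB) ((Finset.card_le_univ _).trans (by simp))
  rw [← hn] at hI hF
  obtain ⟨⟨x, hx, hxC, hxn⟩, hsum, hdown, m, hm0, hm1, hm2, hm3⟩ := hI
  refine ⟨⟨x, ⟨hx, hxC⟩, ?_⟩, ?_⟩
  · simp only [hxn]
  rintro _ ⟨y, ⟨hy, hyC⟩, rfl⟩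
  dsimp only
  by_cases h0 : ∃ k, n k = 0
  · have hne : (Finset.univ.filter (fun k : Fin K => n k = 0)).Nonempty := by
      obtain ⟨k, hk⟩ := h0
      exact ⟨k, by simpa using hk⟩
    obtain ⟨b, hb, hbmin⟩ : ∃ b, n b = 0 ∧ ∀ k, n k = 0 → b ≤ k :=
      ⟨_, (Finset.mem_filter.1 (Finset.min'_mem _ hne)).2,
        fun k hk => Finset.min'_le _ _ (by simpa using hk)⟩
    have hmono : ∀ a c : Fin K, a ≤ c →
        (d + (N : ℝ) * (D - d)) * π c ≤ (d + (N : ℝ) * (D - d)) * π a := fun a c hac =>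
      mul_le_mul_of_nonneg_left (hanti.antitone hac) (by linarith)
    refine cca_opt N K C π hpos hanti d _ (max m ((d + (N : ℝ) * (D - d)) * π b)) hd hB
      (le_max_of_le_left hm0) n hsum ?_ ?_ ?_ ?_ y hy hyC
    · intro k hk
      exact hm1 k ((le_max_left _ _).trans_lt hk)
    · intro k hk
      rcases lt_max_iff.1 hk with h | h
      · exact hm2 k h
      · by_contra hc
        have := hF k b (not_le.1 hc) hb
        linarith
    · intro k hk
      exact le_max_of_le_right (hmono _ _ (hbmin k hk))
    · intro k hk
      refine max_le (hm3 k hk) (hmono _ _ ?_)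
      by_contra hc
      exact hk (hdown _ _ (not_le.1 hc).le hb)
  · exact cca_opt N K C π hpos hanti d _ m hd hB hm0 n hsum hm1 hm2
      (fun k hk => absurd ⟨k, hk⟩ h0) hm3 y hy hyC
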